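/- Let β > 0 and 0 < ω < β. Then there exist infinitely differentiable functions u, v : ℝ → ℝ with u(0) = √(2(β−ω)) and v(0) = 0 that solve the Hamiltonian system u'(x) = −(ω+β)v(x) − v(x)³, v'(x) = (ω−β)u(x) + u(x)³ for all x ∈ ℝ, and there exists a constant C > 0 (depending on β and ω) such that √(u(x)² + v(x)²) ≤ C·exp(−√(β²−ω²)·|x|) for all x ∈ ℝ. -/

import Mathlib

open Real

/-- The quartic `q⁴ cosh⁴(pqx) + p⁴ sinh⁴(pqx)`, whose square root is the common denominator of the
explicit standing wave profile. -/
noncomputable def waveQuartic (p q x : ℝ) : ℝ :=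
  q ^ 4 * cosh (p * q * x) ^ 4 + p ^ 4 * sinh (p * q * x) ^ 4

/-- The first component of the explicit standing wave profile. -/
noncomputable def waveFst (p q x : ℝ) : ℝ :=
  √2 * p * q ^ 2 * cosh (p * q * x) / √(waveQuartic p q x)

/-- The second component of the explicit standing wave profile. -/
noncomputable def waveSnd (p q x : ℝ) : ℝ :=
  √2 * p ^ 2 * q * sinh (p * q * x) / √(waveQuartic p q x)

section

variable {p q : ℝ}

theorem waveQuartic_pos (hq : 0 < q) (x : ℝ) : 0 < waveQuartic p q x := by
  have := cosh_pos (p * q * x)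
  unfold waveQuartic
  positivity

theorem contDiff_waveQuartic (n : WithTop ℕ∞) : ContDiff ℝ n (waveQuartic p q) := by
  unfold waveQuartic
  fun_prop

theorem contDiff_waveFst (hq : 0 < q) (n : WithTop ℕ∞) : ContDiff ℝ n (waveFst p q) :=
  ContDiff.div (by fun_prop)
    ((contDiff_waveQuartic n).sqrt fun x => (waveQuartic_pos hq x).ne')
    fun x => (sqrt_pos.2 (waveQuartic_pos hq x)).ne'

theorem contDiff_waveSnd (hq : 0 < q) (n : WithTop ℕ∞) : ContDiff ℝ n (waveSnd p q) :=
  ContDiff.div (by fun_prop)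
    ((contDiff_waveQuartic n).sqrt fun x => (waveQuartic_pos hq x).ne')
    fun x => (sqrt_pos.2 (waveQuartic_pos hq x)).ne'

theorem hasDerivAt_cosh_mul (k x : ℝ) :
    HasDerivAt (fun y => cosh (k * y)) (k * sinh (k * x)) x := by
  simpa [mul_comm] using ((hasDerivAt_id x).const_mul k).cosh

theorem hasDerivAt_sinh_mul (k x : ℝ) :
    HasDerivAt (fun y => sinh (k * y)) (k * cosh (k * x)) x := by
  simpa [mul_comm] using ((hasDerivAt_id x).const_mul k).sinh

theorem hasDerivAt_sqrt_waveQuartic (hq : 0 < q) (x : ℝ) :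
    HasDerivAt (fun y => √(waveQuartic p q y))
      (2 * (p * q) * sinh (p * q * x) * cosh (p * q * x) *
        (q ^ 4 * cosh (p * q * x) ^ 2 + p ^ 4 * sinh (p * q * x) ^ 2) / √(waveQuartic p q x)) x := by
  have h := ((((hasDerivAt_cosh_mul (p * q) x).pow 4).const_mul (q ^ 4)).add
    (((hasDerivAt_sinh_mul (p * q) x).pow 4).const_mul (p ^ 4))).sqrt
    (waveQuartic_pos (p := p) hq x).ne'
  refine h.congr_deriv ?_
  change _ / (2 * √(waveQuartic p q x)) = _
  have := (sqrt_pos.2 (waveQuartic_pos (p := p) hq x)).ne'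
  field_simp
  push_cast
  ring

theorem hasDerivAt_waveFst (hq : 0 < q) (x : ℝ) :
    HasDerivAt (waveFst p q) (-q ^ 2 * waveSnd p q x - waveSnd p q x ^ 3) x := by
  have hR := sqrt_pos.2 (waveQuartic_pos (p := p) hq x)
  have h := ((hasDerivAt_cosh_mul (p * q) x).const_mul (√2 * p * q ^ 2)).div
    (hasDerivAt_sqrt_waveQuartic (p := p) hq x) hR.ne'
  refine h.congr_deriv ?_
  have hP : √(waveQuartic p q x) ^ 2 =
      q ^ 4 * cosh (p * q * x) ^ 4 + p ^ 4 * sinh (p * q * x) ^ 4 :=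
    sq_sqrt (waveQuartic_pos hq x).le
  have h2 : √2 ^ 2 = 2 := sq_sqrt zero_le_two
  have hc := cosh_sq (p * q * x)
  unfold waveSnd
  generalize √(waveQuartic p q x) = R at *
  generalize cosh (p * q * x) = c at *
  generalize sinh (p * q * x) = s at *
  generalize √2 = r at *
  field_simp
  have hc4 : c ^ 4 = (s ^ 2 + 1) ^ 2 := by rw [← hc]; ring
  simp only [h2, hP, hc, hc4]
  ring

theorem hasDerivAt_waveSnd (hq : 0 < q) (x : ℝ) :
    HasDerivAt (waveSnd p q) (-p ^ 2 * waveFst p q x + waveFst p q x ^ 3) x := by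
  have hR := sqrt_pos.2 (waveQuartic_pos (p := p) hq x)
  have h := ((hasDerivAt_sinh_mul (p * q) x).const_mul (√2 * p ^ 2 * q)).div
    (hasDerivAt_sqrt_waveQuartic (p := p) hq x) hR.ne'
  refine h.congr_deriv ?_
  have hP : √(waveQuartic p q x) ^ 2 =
      q ^ 4 * cosh (p * q * x) ^ 4 + p ^ 4 * sinh (p * q * x) ^ 4 :=
    sq_sqrt (waveQuartic_pos hq x).le
  have h2 : √2 ^ 2 = 2 := sq_sqrt zero_le_two
  have hc := cosh_sq (p * q * x)
  unfold waveFst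
  generalize √(waveQuartic p q x) = R at *
  generalize cosh (p * q * x) = c at *
  generalize sinh (p * q * x) = s at *
  generalize √2 = r at *
  field_simp
  have hc4 : c ^ 4 = (s ^ 2 + 1) ^ 2 := by rw [← hc]; ring
  simp only [h2, hP, hc, hc4]
  ring

theorem waveFst_zero (hq : 0 < q) : waveFst p q 0 = √2 * p := by
  have : √(q ^ 4) = q ^ 2 := by
    rw [show q ^ 4 = (q ^ 2) ^ 2 by ring, sqrt_sq (by positivity)]
  simp [waveFst, waveQuartic, this, hq.ne']

theorem waveSnd_zero : waveSnd p q 0 = 0 := by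
  simp [waveSnd]

theorem waveFst_sq_add_waveSnd_sq_le (hq : 0 < q) (x : ℝ) :
    waveFst p q x ^ 2 + waveSnd p q x ^ 2 ≤
      2 * p ^ 2 * (p ^ 2 + q ^ 2) / (q ^ 2 * cosh (p * q * x) ^ 2) := by
  have hP := waveQuartic_pos (p := p) hq x
  have hc := cosh_pos (p * q * x)
  have h : waveFst p q x ^ 2 + waveSnd p q x ^ 2 =
      2 * p ^ 2 * q ^ 2 * (q ^ 2 * cosh (p * q * x) ^ 2 + p ^ 2 * sinh (p * q * x) ^ 2) /
        waveQuartic p q x := by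
    simp only [waveFst, waveSnd, div_pow, mul_pow, sq_sqrt hP.le, sq_sqrt zero_le_two]
    ring
  have hs : sinh (p * q * x) ^ 2 ≤ cosh (p * q * x) ^ 2 := by
    linarith [cosh_sq (p * q * x)]
  rw [h]
  calc _ ≤ 2 * p ^ 2 * q ^ 2 * (q ^ 2 * cosh (p * q * x) ^ 2 + p ^ 2 * cosh (p * q * x) ^ 2) /
        (q ^ 4 * cosh (p * q * x) ^ 4) := by
        gcongr
        exact le_add_of_nonneg_right (by positivity)
    _ = _ := by field_simp; ring

theorem exp_abs_le_two_mul_cosh (y : ℝ) : exp |y| ≤ 2 * cosh y := by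
  rw [← cosh_abs, cosh_eq]
  linarith [exp_pos (-|y|)]

theorem sqrt_waveFst_sq_add_waveSnd_sq_le (hp : 0 < p) (hq : 0 < q) (x : ℝ) :
    √(waveFst p q x ^ 2 + waveSnd p q x ^ 2) ≤
      2 * p / q * √(2 * (p ^ 2 + q ^ 2)) * exp (-(p * q) * |x|) := by
  refine sqrt_le_iff.2 ⟨by positivity, (waveFst_sq_add_waveSnd_sq_le hq x).trans ?_⟩
  have hc := exp_abs_le_two_mul_cosh (p * q * x)
  rw [abs_mul, abs_of_pos (mul_pos hp hq)] at hc
  have he := exp_pos (p * q * |x|)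
  calc 2 * p ^ 2 * (p ^ 2 + q ^ 2) / (q ^ 2 * cosh (p * q * x) ^ 2)
      = 8 * p ^ 2 * (p ^ 2 + q ^ 2) / (q ^ 2 * (2 * cosh (p * q * x)) ^ 2) := by
        have := (cosh_pos (p * q * x)).ne'
        field_simp
        ring
    _ ≤ 8 * p ^ 2 * (p ^ 2 + q ^ 2) / (q ^ 2 * exp (p * q * |x|) ^ 2) := by gcongr
    _ = _ := by
        rw [mul_pow, mul_pow, sq_sqrt (by positivity), neg_mul, exp_neg]
        field_simp
        ring

end

/-- Existence of exponentially localized standing waves for the cubic Dirac equation with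
constant mass `β` and frequency `ω ∈ (0, β)`: the Hamiltonian system
`u' = −(ω+β)v − v³`, `v' = (ω−β)u + u³` admits a smooth solution with
`u(0) = √(2(β−ω))`, `v(0) = 0` decaying exponentially at rate `√(β²−ω²)`. -/
theorem standing_wave_existence (β ω : ℝ) (hβ : 0 < β) (hω : 0 < ω) (hωβ : ω < β) :
    ∃ u v : ℝ → ℝ, ContDiff ℝ (⊤ : ℕ∞) u ∧ ContDiff ℝ (⊤ : ℕ∞) v ∧
      u 0 = Real.sqrt (2 * (β - ω)) ∧ v 0 = 0 ∧
      (∀ x : ℝ, deriv u x = -(ω + β) * v x - (v x) ^ 3) ∧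
      (∀ x : ℝ, deriv v x = (ω - β) * u x + (u x) ^ 3) ∧
      ∃ C : ℝ, 0 < C ∧ ∀ x : ℝ,
        Real.sqrt ((u x) ^ 2 + (v x) ^ 2) ≤ C * Real.exp (-Real.sqrt (β ^ 2 - ω ^ 2) * |x|) := by
  have hd : 0 < β - ω := sub_pos.2 hωβ
  have hs : 0 < β + ω := add_pos hβ hω
  have hp : 0 < √(β - ω) := sqrt_pos.2 hd
  have hq : 0 < √(β + ω) := sqrt_pos.2 hs
  have hp2 : √(β - ω) ^ 2 = β - ω := sq_sqrt hd.le
  have hq2 : √(β + ω) ^ 2 = β + ω := sq_sqrt hs.le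
  have hpq : √(β ^ 2 - ω ^ 2) = √(β - ω) * √(β + ω) := by
    rw [← sqrt_mul hd.le]
    congr 1
    ring
  refine ⟨waveFst √(β - ω) √(β + ω), waveSnd √(β - ω) √(β + ω), contDiff_waveFst hq _,
    contDiff_waveSnd hq _, ?_, waveSnd_zero, fun x => ?_, fun x => ?_,
    2 * √(β - ω) / √(β + ω) * √(2 * (√(β - ω) ^ 2 + √(β + ω) ^ 2)), by positivity, fun x => ?_⟩
  · rw [waveFst_zero hq, sqrt_mul zero_le_two]
  · rw [(hasDerivAt_waveFst hq x).deriv, hq2, add_comm β ω]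
  · rw [(hasDerivAt_waveSnd hq x).deriv, hp2, neg_sub]
  · rw [hpq]
    exact sqrt_waveFst_sq_add_waveSnd_sq_le hp hq x
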